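/- Let f : ℕ → ℝ satisfy |f(n)| ≪ (log n)^C for some C > 0 and have zero-mean distribution level ϑ. Fix a k-element set H of distinct nonnegative integers, integers l_1, l_2 ≥ 0, and ε > 0. Then for every A > 0, whenever R ≤ N^{(ϑ−ε)/2} one has (1/N) Σ_{N ≤ n < 2N} Λ_R(n; H, l_1) Λ_R(n; H, l_2) f(n) ≪_{k, l_1, l_2, C, A, ε} (log N)^{−A}. -/

import Mathlib

open Filter

/-- The Liouville function `λ(n) = (-1)^Ω(n)`. -/
noncomputable def lio (n : ℕ) : ℝ := (-1) ^ n.primeFactorsList.length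

/-- `θ(n) = log n` if `n` is prime, `0` otherwise. -/
noncomputable def theta (n : ℕ) : ℝ := if n.Prime then Real.log n else 0

/-- `max_a |∑_{n ≤ N, n ≡ a (q)} f(n)|`. -/
noncomputable def maxAbs (f : ℕ → ℝ) (q N : ℕ) : ℝ :=
  ⨆ a : ℕ, |∑ n ∈ Finset.Icc 1 N, if n % q = a % q then f n else 0|

/-- `f` has (zero-mean) distribution level `ϑ`. -/
def HasLevel (f : ℕ → ℝ) (ϑ : ℝ) : Prop :=
  ∀ ε > (0 : ℝ), ∀ A > (0 : ℝ), ∃ C > (0 : ℝ), ∀ N : ℕ, 2 ≤ N →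
    ∑ q ∈ Finset.Icc 1 ⌊(N : ℝ) ^ (ϑ - ε)⌋₊, maxAbs f q N ≤ C * N / Real.log N ^ A

/-- `max_{(a,q)=1} |∑_{p ≤ N, p ≡ a (q)} log p - N/φ(q)|`. -/
noncomputable def primeMaxAbs (q N : ℕ) : ℝ :=
  ⨆ a : ℕ, if Nat.Coprime a q then
    |(∑ p ∈ Finset.Icc 1 N, if p.Prime ∧ p % q = a % q then Real.log p else 0)
      - N / q.totient|
  else 0

/-- The primes have distribution level `ϑ` (Bombieri–Vinogradov/Elliott–Halberstam type). -/
def PrimesLevel (ϑ : ℝ) : Prop :=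
  ∀ ε > (0 : ℝ), ∀ A > (0 : ℝ), ∃ C > (0 : ℝ), ∀ N : ℕ, 2 ≤ N →
    ∑ q ∈ Finset.Icc 1 ⌊(N : ℝ) ^ (ϑ - ε)⌋₊, primeMaxAbs q N ≤ C * N / Real.log N ^ A

/-- Hypothesis D(ϑ, h): the primes and the four auxiliary Liouville-type sequences
all have distribution level `ϑ`. -/
def HypD (ϑ : ℝ) (h : ℕ) : Prop :=
  PrimesLevel ϑ ∧
  HasLevel lio ϑ ∧
  HasLevel (fun n => lio n * lio (n + h)) ϑ ∧
  HasLevel (fun n => theta n * lio (n + h)) ϑ ∧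
  HasLevel (fun n => if h < n then theta n * lio (n - h) else 0) ϑ

/-- The Goldston–Pintz–Yıldırım weight
`Λ_R(n; H, l) = (1/(k+l)!) ∑_{d ≤ R, d ∣ P_H(n)} μ(d) (log (R/d))^{k+l}`. -/
noncomputable def LambdaR (R : ℝ) (n : ℕ) (H : Finset ℕ) (l : ℕ) : ℝ :=
  (1 / (H.card + l).factorial) *
    ∑ d ∈ Finset.Icc 1 ⌊R⌋₊,
      if d ∣ ∏ hi ∈ H, (n + hi) then
        (ArithmeticFunction.moebius d : ℝ) * Real.log (R / d) ^ (H.card + l)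
      else 0

/-- `ν_m(H)`: the number of residue classes `n` mod `m` with `m ∣ P_H(n)`. -/
def nu (H : Finset ℕ) (m : ℕ) : ℕ :=
  ((Finset.range m).filter fun n => m ∣ ∏ hi ∈ H, (n + hi)).card

/-- The singular series `𝔖(H) = ∏_p (1 - ν_p(H)/p)(1 - 1/p)^{-k}`. -/
noncomputable def singSeries (H : Finset ℕ) : ℝ :=
  ∏' p : Nat.Primes, (1 - (nu H p : ℝ) / (p : ℕ)) * (1 - 1 / ((p : ℕ) : ℝ)) ^ (-(H.card : ℤ))

/-- `𝔖₀(h) = ∏_{p ∣ h} (1-1/p)⁻¹ ∏_{p ∤ h} (1 - 1/(p-1)²)`. -/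
noncomputable def singSeries0 (h : ℕ) : ℝ :=
  ∏' p : Nat.Primes, if (p : ℕ) ∣ h then (1 - 1 / ((p : ℕ) : ℝ))⁻¹
    else 1 - 1 / (((p : ℕ) : ℝ) - 1) ^ 2

/-- The number of divisors is submultiplicative. -/
theorem Nat.card_divisors_mul_le (m n : ℕ) :
    (m * n).divisors.card ≤ m.divisors.card * n.divisors.card := by
  open scoped Pointwise in
  rw [Nat.divisors_mul]
  exact Finset.card_mul_le

theorem sum_card_divisors_pow_div_le (Q j : ℕ) :
    ∑ q ∈ Finset.Icc 1 Q, (q.divisors.card : ℝ) ^ j / q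
      ≤ (∑ q ∈ Finset.Icc 1 Q, (1 : ℝ) / q) ^ 2 ^ j := by
  induction j with
  | zero => simp
  | succ j ih =>
    have step : ∑ q ∈ Finset.Icc 1 Q, (q.divisors.card : ℝ) ^ (j + 1) / q
        ≤ (∑ q ∈ Finset.Icc 1 Q, (q.divisors.card : ℝ) ^ j / q) ^ 2 := by
      calc ∑ q ∈ Finset.Icc 1 Q, (q.divisors.card : ℝ) ^ (j + 1) / q
          ≤ ∑ q ∈ Finset.Icc 1 Q,
              ∑ x ∈ Finset.Icc 1 Q ×ˢ Finset.Icc 1 Q with x.1 * x.2 = q,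
                ((x.1.divisors.card : ℝ) ^ j / x.1) * ((x.2.divisors.card : ℝ) ^ j / x.2) := by
            refine Finset.sum_le_sum fun q hq => ?_
            rw [Finset.mem_Icc] at hq
            have hfilter : (Finset.Icc 1 Q ×ˢ Finset.Icc 1 Q).filter (fun x => x.1 * x.2 = q)
                = q.divisorsAntidiagonal := by
              ext ⟨a, b⟩
              simp only [Finset.mem_filter, Finset.mem_product, Finset.mem_Icc,
                Nat.mem_divisorsAntidiagonal]
              constructor
              · rintro ⟨-, h⟩
                exact ⟨h, by lia⟩
              · rintro ⟨h, h0⟩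
                have ha : 0 < a := Nat.pos_of_ne_zero (by rintro rfl; simp at h; lia)
                have hb : 0 < b := Nat.pos_of_ne_zero (by rintro rfl; simp at h; lia)
                have := Nat.le_mul_of_pos_right a hb
                have := Nat.le_mul_of_pos_left b ha
                exact ⟨⟨⟨ha, by lia⟩, hb, by lia⟩, h⟩
            have hcard : q.divisorsAntidiagonal.card = q.divisors.card := by
              rw [← Nat.map_div_right_divisors, Finset.card_map]
            rw [hfilter, pow_succ', mul_div_assoc, ← nsmul_eq_mul, ← hcard]
            refine Finset.card_nsmul_le_sum q.divisorsAntidiagonal _ _ fun x hx => ?_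
            rw [hcard]
            obtain ⟨rfl, -⟩ := Nat.mem_divisorsAntidiagonal.1 hx
            rw [div_mul_div_comm, ← mul_pow, Nat.cast_mul]
            gcongr
            exact_mod_cast Nat.card_divisors_mul_le _ _
        _ ≤ ∑ x ∈ Finset.Icc 1 Q ×ˢ Finset.Icc 1 Q,
              ((x.1.divisors.card : ℝ) ^ j / x.1) * ((x.2.divisors.card : ℝ) ^ j / x.2) :=
            Finset.sum_fiberwise_le_sum_of_sum_fiber_nonneg fun _ _ =>
              Finset.sum_nonneg fun _ _ => by positivity
        _ = (∑ q ∈ Finset.Icc 1 Q, (q.divisors.card : ℝ) ^ j / q) ^ 2 := by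
            rw [sq, Finset.sum_mul_sum, Finset.sum_product]
    refine step.trans ?_
    rw [pow_succ 2 j, pow_mul]
    gcongr

theorem sum_one_div_Icc_le (Q : ℕ) :
    ∑ q ∈ Finset.Icc 1 Q, (1 : ℝ) / q ≤ 1 + Real.log Q := by
  have h := harmonic_le_one_add_log Q
  rw [harmonic_eq_sum_Icc] at h
  simpa using h

theorem abs_sum_mod_eq_le_maxAbs (f : ℕ → ℝ) (q M a : ℕ) :
    |∑ n ∈ Finset.Icc 1 M, if n % q = a % q then f n else 0| ≤ maxAbs f q M := by
  refine le_ciSup (f := fun a : ℕ =>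
    |∑ n ∈ Finset.Icc 1 M, if n % q = a % q then f n else 0|) ?_ a
  refine ⟨∑ n ∈ Finset.Icc 1 M, |f n|, ?_⟩
  rintro _ ⟨b, rfl⟩
  refine (Finset.abs_sum_le_sum_abs _ _).trans (Finset.sum_le_sum fun n _ => ?_)
  split_ifs
  · exact le_rfl
  · simp

theorem maxAbs_nonneg (f : ℕ → ℝ) (q M : ℕ) : 0 ≤ maxAbs f q M :=
  (abs_nonneg _).trans (abs_sum_mod_eq_le_maxAbs f q M 0)

theorem card_filter_mod_eq_le {q : ℕ} (hq : 0 < q) (M a : ℕ) :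
    (((Finset.Icc 1 M).filter fun n => n % q = a % q).card : ℝ) ≤ M / q + 1 := by
  have h := Nat.Ioc_filter_modEq_card 0 M hq a
  have hIoc : Finset.Ioc 0 M = Finset.Icc 1 M := rfl
  rw [hIoc] at h
  have hq' : (0 : ℚ) < q := by exact_mod_cast hq
  have key : (((Finset.Icc 1 M).filter fun n => n % q = a % q).card : ℚ) ≤ M / q + 1 := by
    have h' : (((Finset.Icc 1 M).filter fun n => n % q = a % q).card : ℤ)
      = max (⌊((M : ℚ) - a) / (q : ℚ)⌋ - ⌊(((0 : ℕ) : ℚ) - a) / (q : ℚ)⌋) 0 := h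
    have h2 : (((Finset.Icc 1 M).filter fun n => n % q = a % q).card : ℚ)
      = ((max (⌊((M : ℚ) - a) / (q : ℚ)⌋ - ⌊(((0 : ℕ) : ℚ) - a) / (q : ℚ)⌋) 0 : ℤ) : ℚ) := by
      exact_mod_cast h'
    rw [h2]
    push_cast
    refine max_le ?_ (by positivity)
    have h3 := Int.floor_le (((M : ℚ) - a) / (q : ℚ))
    have h4 := Int.lt_floor_add_one ((0 - (a : ℚ)) / (q : ℚ))
    have h5 : ((M : ℚ) - a) / q - (0 - (a : ℚ)) / q = M / q := by ring
    linarith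
  have h6 : (((((Finset.Icc 1 M).filter fun n => n % q = a % q).card : ℚ)) : ℝ)
      ≤ ((M / q + 1 : ℚ) : ℝ) := Rat.cast_le.2 key
  push_cast at h6
  exact h6

theorem maxAbs_le {f : ℕ → ℝ} {q M : ℕ} {B : ℝ} (hq : 0 < q) (hB : 0 ≤ B)
    (hf : ∀ n ∈ Finset.Icc 1 M, |f n| ≤ B) : maxAbs f q M ≤ B * (M / q + 1) := by
  refine ciSup_le fun a => ?_
  rw [← Finset.sum_filter]
  refine (Finset.abs_sum_le_sum_abs _ _).trans ?_
  refine (Finset.sum_le_card_nsmul _ _ B fun n hn => hf n (Finset.mem_filter.1 hn).1).trans ?_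
  rw [nsmul_eq_mul, mul_comm]
  exact mul_le_mul_of_nonneg_left (card_filter_mod_eq_le hq M a) hB

/-- A polynomial `∏ (n + h)` has at most `τ(q) ^ #H` roots modulo a squarefree `q`. -/
theorem nu_le_card_divisors_pow (H : Finset ℕ) {q : ℕ} (hq : Squarefree q) :
    nu H q ≤ q.divisors.card ^ H.card := by
  classical
  rw [nu, ← Finset.prod_const, ← Finset.card_pi]
  refine Finset.card_le_card_of_injOn (fun n => fun h _ => q.gcd (n + h)) ?_ ?_
  · intro n _
    simp only [Finset.mem_coe, Finset.mem_pi]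
    intro h _
    exact Nat.mem_divisors.2 ⟨Nat.gcd_dvd_left _ _, hq.ne_zero⟩
  · intro m hm n hn hmn
    simp only [Finset.coe_filter, Set.mem_ofPred_eq, Finset.mem_range] at hm hn
    have hmod : m ≡ n [MOD q] := by
      have hdvd : (∏ p ∈ q.primeFactors, (p : ℤ)) ∣ (n : ℤ) - m := by
        refine Finset.prod_dvd_of_coprime ?_ ?_
        · intro p hp p' hp' hne
          exact Nat.isCoprime_iff_coprime.2 ((Nat.coprime_primes
            (Nat.prime_of_mem_primeFactors hp) (Nat.prime_of_mem_primeFactors hp')).2 hne)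
        · intro p hp
          have hpp := Nat.prime_of_mem_primeFactors hp
          have hpq := Nat.dvd_of_mem_primeFactors hp
          obtain ⟨h, hh, hph⟩ := (hpp.prime.dvd_finsetProd_iff _).1 (hpq.trans hm.2)
          have hgcd : q.gcd (m + h) = q.gcd (n + h) := congrFun (congrFun hmn h) hh
          have hpn : p ∣ n + h :=
            (hgcd ▸ Nat.dvd_gcd hpq hph : p ∣ q.gcd (n + h)).trans (Nat.gcd_dvd_right _ _)
          have := dvd_sub (Int.natCast_dvd_natCast.2 hpn) (Int.natCast_dvd_natCast.2 hph)
          simpa using this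
      have hprod : (∏ p ∈ q.primeFactors, (p : ℤ)) = q := by
        rw [← Nat.cast_prod, Nat.prod_primeFactors_of_squarefree hq]
      rw [hprod] at hdvd
      exact Nat.modEq_iff_dvd.2 hdvd
    exact hmod.eq_of_lt_of_lt hm.1 hn.1

theorem dvd_prod_add_mod_iff (H : Finset ℕ) (q n : ℕ) :
    (q ∣ ∏ h ∈ H, (n % q + h)) ↔ q ∣ ∏ h ∈ H, (n + h) := by
  refine Nat.ModEq.dvd_iff ?_ dvd_rfl
  simp only [Nat.ModEq]
  rw [Finset.prod_nat_mod, Finset.prod_nat_mod (f := fun h => n + h)]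
  simp

theorem abs_sum_dvd_prod_le (f : ℕ → ℝ) (H : Finset ℕ) (M : ℕ) {q : ℕ} (hq : Squarefree q) :
    |∑ n ∈ Finset.Icc 1 M, if q ∣ ∏ h ∈ H, (n + h) then f n else 0|
      ≤ (q.divisors.card : ℝ) ^ H.card * maxAbs f q M := by
  have hq0 : 0 < q := Nat.pos_of_ne_zero hq.ne_zero
  have hsum : (∑ n ∈ Finset.Icc 1 M, if q ∣ ∏ h ∈ H, (n + h) then f n else 0)
      = ∑ r ∈ (Finset.range q).filter (fun r => q ∣ ∏ h ∈ H, (r + h)),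
          ∑ n ∈ Finset.Icc 1 M, if n % q = r % q then f n else 0 := by
    rw [Finset.sum_comm]
    refine Finset.sum_congr rfl fun n _ => ?_
    have hr : ∀ r ∈ (Finset.range q).filter (fun r => q ∣ ∏ h ∈ H, (r + h)),
        (if n % q = r % q then f n else 0) = if n % q = r then f n else 0 := by
      intro r hr
      rw [Nat.mod_eq_of_lt (Finset.mem_range.1 (Finset.mem_filter.1 hr).1)]
    rw [Finset.sum_congr rfl hr, Finset.sum_ite_eq]
    simp [Nat.mod_lt _ hq0, dvd_prod_add_mod_iff]
  rw [hsum]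
  refine (Finset.abs_sum_le_sum_abs _ _).trans ?_
  refine (Finset.sum_le_card_nsmul _ _ (maxAbs f q M)
    fun r _ => abs_sum_mod_eq_le_maxAbs f q M r).trans ?_
  rw [nsmul_eq_mul]
  refine mul_le_mul_of_nonneg_right ?_ (maxAbs_nonneg f q M)
  exact_mod_cast nu_le_card_divisors_pow H hq

theorem sum_Ico_two_mul_eq (g : ℕ → ℝ) {N : ℕ} (hN : 1 ≤ N) :
    ∑ n ∈ Finset.Ico N (2 * N), g n
      = ∑ n ∈ Finset.Icc 1 (2 * N - 1), g n - ∑ n ∈ Finset.Icc 1 (N - 1), g n := by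
  have h1 : Finset.Icc 1 (2 * N - 1) = Finset.Ico 1 (2 * N) := by ext; simp; lia
  have h2 : Finset.Icc 1 (N - 1) = Finset.Ico 1 N := by ext; simp; lia
  rw [h1, h2, ← Finset.sum_Ico_consecutive g hN (by lia : N ≤ 2 * N)]
  ring

theorem abs_sum_Ico_dvd_prod_le (f : ℕ → ℝ) (H : Finset ℕ) {N q : ℕ} (hN : 1 ≤ N)
    (hq : Squarefree q) :
    |∑ n ∈ Finset.Ico N (2 * N), if q ∣ ∏ h ∈ H, (n + h) then f n else 0|
      ≤ (q.divisors.card : ℝ) ^ H.card * (maxAbs f q (2 * N - 1) + maxAbs f q (N - 1)) := by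
  rw [sum_Ico_two_mul_eq _ hN, mul_add]
  exact (abs_sub _ _).trans
    (add_le_add (abs_sum_dvd_prod_le f H _ hq) (abs_sum_dvd_prod_le f H _ hq))

theorem Nat.Squarefree.lcm {a b : ℕ} (ha : Squarefree a) (hb : Squarefree b) :
    Squarefree (a.lcm b) := by
  have h0 : a.lcm b ≠ 0 := Nat.lcm_ne_zero ha.ne_zero hb.ne_zero
  rw [Nat.squarefree_iff_factorization_le_one h0]
  intro p
  rw [Nat.factorization_lcm ha.ne_zero hb.ne_zero]
  exact sup_le (ha.natFactorization_le_one p) (hb.natFactorization_le_one p)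

theorem sum_lcm_le {G : ℕ → ℝ} (hG : ∀ q, 0 ≤ G q) {D Q : ℕ} (hQ : D * D ≤ Q) :
    ∑ x ∈ Finset.Icc 1 D ×ˢ Finset.Icc 1 D, G (x.1.lcm x.2)
      ≤ ∑ q ∈ Finset.Icc 1 Q, (q.divisors.card : ℝ) ^ 2 * G q := by
  rw [← Finset.sum_fiberwise_of_maps_to (t := Finset.Icc 1 Q) (g := fun x => x.1.lcm x.2)]
  · refine Finset.sum_le_sum fun q hq => ?_
    rw [Finset.mem_Icc] at hq
    have hsub : (Finset.Icc 1 D ×ˢ Finset.Icc 1 D).filter (fun x => x.1.lcm x.2 = q)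
        ⊆ q.divisors ×ˢ q.divisors := by
      intro x hx
      obtain ⟨-, rfl⟩ := Finset.mem_filter.1 hx
      exact Finset.mem_product.2 ⟨Nat.mem_divisors.2 ⟨Nat.dvd_lcm_left _ _, by lia⟩,
        Nat.mem_divisors.2 ⟨Nat.dvd_lcm_right _ _, by lia⟩⟩
    calc ∑ x ∈ Finset.Icc 1 D ×ˢ Finset.Icc 1 D with x.1.lcm x.2 = q, G (x.1.lcm x.2)
        = ∑ x ∈ Finset.Icc 1 D ×ˢ Finset.Icc 1 D with x.1.lcm x.2 = q, G q :=
          Finset.sum_congr rfl fun x hx => by rw [(Finset.mem_filter.1 hx).2]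
      _ ≤ ∑ x ∈ q.divisors ×ˢ q.divisors, G q :=
          Finset.sum_le_sum_of_subset_of_nonneg hsub fun _ _ _ => hG q
      _ = (q.divisors.card : ℝ) ^ 2 * G q := by
          rw [Finset.sum_const, Finset.card_product, nsmul_eq_mul]
          push_cast
          ring
  · intro x hx
    simp only [Finset.mem_product, Finset.mem_Icc] at hx ⊢
    refine ⟨Nat.lcm_pos hx.1.1 hx.2.1, ?_⟩
    exact (Nat.le_of_dvd (Nat.mul_pos hx.1.1 hx.2.1) (Nat.lcm_dvd_mul _ _)).trans
      ((Nat.mul_le_mul hx.1.2 hx.2.2).trans hQ)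

theorem abs_sum_LambdaR_mul_LambdaR_le (f : ℕ → ℝ) (H : Finset ℕ) (l₁ l₂ : ℕ) {N Q : ℕ}
    (hN : 1 ≤ N) {R : ℝ} (hR : 1 ≤ R) (hQ : ⌊R⌋₊ * ⌊R⌋₊ ≤ Q) :
    |∑ n ∈ Finset.Ico N (2 * N), LambdaR R n H l₁ * LambdaR R n H l₂ * f n|
      ≤ Real.log R ^ ((H.card + l₁) + (H.card + l₂)) *
        ∑ q ∈ Finset.Icc 1 Q, (q.divisors.card : ℝ) ^ (H.card + 2) *
          (maxAbs f q (2 * N - 1) + maxAbs f q (N - 1)) := by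
  set w : ℕ → ℕ → ℝ := fun l d => (1 / (H.card + l).factorial) *
    ((ArithmeticFunction.moebius d : ℝ) * Real.log (R / d) ^ (H.card + l)) with hw
  have hlogR : 0 ≤ Real.log R := Real.log_nonneg hR
  have hw_le : ∀ l, ∀ d ∈ Finset.Icc 1 ⌊R⌋₊, |w l d| ≤ Real.log R ^ (H.card + l) := by
    intro l d hd
    rw [Finset.mem_Icc] at hd
    have hd1 : (1 : ℝ) ≤ d := by exact_mod_cast hd.1
    have hdR : (d : ℝ) ≤ R := (Nat.le_floor_iff (by linarith)).1 hd.2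
    have hlog0 : 0 ≤ Real.log (R / d) := Real.log_nonneg ((one_le_div (by linarith)).2 hdR)
    have hlog1 : Real.log (R / d) ≤ Real.log R :=
      Real.log_le_log (by positivity) (div_le_self (by linarith) hd1)
    have hfac : |(1 : ℝ) / (H.card + l).factorial| ≤ 1 := by
      rw [abs_of_nonneg (by positivity)]
      exact div_le_one_of_le₀ (by exact_mod_cast Nat.factorial_pos _) (by positivity)
    have hmu : |(ArithmeticFunction.moebius d : ℝ)| ≤ 1 := by
      exact_mod_cast ArithmeticFunction.abs_moebius_le_one
    rw [hw]
    simp only [abs_mul]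
    calc |(1 : ℝ) / (H.card + l).factorial| * (|(ArithmeticFunction.moebius d : ℝ)| *
            |Real.log (R / d) ^ (H.card + l)|)
        ≤ 1 * (1 * Real.log R ^ (H.card + l)) := by
          gcongr
          rw [abs_of_nonneg (by positivity)]
          gcongr
      _ = Real.log R ^ (H.card + l) := by ring
  have hw_zero : ∀ l d, ¬ Squarefree d → w l d = 0 := by
    intro l d hd
    simp [hw, ArithmeticFunction.moebius_eq_zero_of_not_squarefree hd]
  have hLambda : ∀ l n, LambdaR R n H l
      = ∑ d ∈ Finset.Icc 1 ⌊R⌋₊, if d ∣ ∏ h ∈ H, (n + h) then w l d else 0 := by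
    intro l n
    rw [LambdaR, Finset.mul_sum]
    refine Finset.sum_congr rfl fun d _ => ?_
    split_ifs <;> simp [hw]
  have hexpand : ∑ n ∈ Finset.Ico N (2 * N), LambdaR R n H l₁ * LambdaR R n H l₂ * f n
      = ∑ x ∈ Finset.Icc 1 ⌊R⌋₊ ×ˢ Finset.Icc 1 ⌊R⌋₊, w l₁ x.1 * w l₂ x.2 *
          ∑ n ∈ Finset.Ico N (2 * N), if x.1.lcm x.2 ∣ ∏ h ∈ H, (n + h) then f n else 0 := by
    simp only [Finset.mul_sum (Finset.Ico N (2 * N))]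
    rw [Finset.sum_comm]
    refine Finset.sum_congr rfl fun n _ => ?_
    rw [hLambda, hLambda, Finset.sum_mul_sum, Finset.sum_product, Finset.sum_mul]
    refine Finset.sum_congr rfl fun a _ => ?_
    rw [Finset.sum_mul]
    refine Finset.sum_congr rfl fun b _ => ?_
    simp only [Nat.lcm_dvd_iff]
    by_cases ha : a ∣ ∏ h ∈ H, (n + h) <;> by_cases hb : b ∣ ∏ h ∈ H, (n + h) <;> simp [ha, hb]
  set G : ℕ → ℝ := fun q => (q.divisors.card : ℝ) ^ H.card *
    (maxAbs f q (2 * N - 1) + maxAbs f q (N - 1)) with hG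
  have hG0 : ∀ q, 0 ≤ G q := fun q =>
    mul_nonneg (by positivity) (add_nonneg (maxAbs_nonneg _ _ _) (maxAbs_nonneg _ _ _))
  rw [hexpand]
  calc |∑ x ∈ Finset.Icc 1 ⌊R⌋₊ ×ˢ Finset.Icc 1 ⌊R⌋₊, w l₁ x.1 * w l₂ x.2 *
          ∑ n ∈ Finset.Ico N (2 * N), if x.1.lcm x.2 ∣ ∏ h ∈ H, (n + h) then f n else 0|
      ≤ ∑ x ∈ Finset.Icc 1 ⌊R⌋₊ ×ˢ Finset.Icc 1 ⌊R⌋₊,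
          Real.log R ^ ((H.card + l₁) + (H.card + l₂)) * G (x.1.lcm x.2) := by
        refine (Finset.abs_sum_le_sum_abs _ _).trans (Finset.sum_le_sum fun x hx => ?_)
        obtain ⟨hx1, hx2⟩ := Finset.mem_product.1 hx
        have hnonneg : 0 ≤ Real.log R ^ ((H.card + l₁) + (H.card + l₂)) * G (x.1.lcm x.2) :=
          mul_nonneg (by positivity) (hG0 _)
        by_cases hs1 : Squarefree x.1
        · by_cases hs2 : Squarefree x.2
          · rw [abs_mul, abs_mul, pow_add]
            gcongr
            · exact hw_le _ _ hx1
            · exact hw_le _ _ hx2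
            · exact abs_sum_Ico_dvd_prod_le f H hN (Nat.Squarefree.lcm hs1 hs2)
          · simpa [hw_zero l₂ _ hs2] using hnonneg
        · simpa [hw_zero l₁ _ hs1] using hnonneg
    _ ≤ Real.log R ^ ((H.card + l₁) + (H.card + l₂)) *
          ∑ q ∈ Finset.Icc 1 Q, (q.divisors.card : ℝ) ^ 2 * G q := by
        rw [← Finset.mul_sum]
        exact mul_le_mul_of_nonneg_left (sum_lcm_le hG0 hQ) (by positivity)
    _ = _ := by
        congr 1
        refine Finset.sum_congr rfl fun q _ => ?_
        rw [hG]
        ring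

/-- A function with distribution level exceeding `1` vanishes at all positive integers. -/
theorem HasLevel.eq_zero {f : ℕ → ℝ} {ϑ : ℝ} (hlevel : HasLevel f ϑ) (hϑ : 1 < ϑ) {n : ℕ}
    (hn : 1 ≤ n) : f n = 0 := by
  obtain ⟨C, -, hC⟩ := hlevel ((ϑ - 1) / 2) (by linarith) 1 one_pos
  have hlog : Tendsto (fun N : ℕ => C / Real.log N) atTop (nhds 0) :=
    tendsto_const_nhds.div_atTop (Real.tendsto_log_atTop.comp tendsto_natCast_atTop_atTop)
  have hpow : ∀ᶠ N : ℕ in atTop, (2 : ℝ) ≤ (N : ℝ) ^ ((ϑ - 1) / 2) :=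
    ((tendsto_rpow_atTop (by linarith : 0 < (ϑ - 1) / 2)).comp
      tendsto_natCast_atTop_atTop).eventually_ge_atTop 2
  have hle : |f n| ≤ 0 := by
    refine ge_of_tendsto hlog ?_
    filter_upwards [hpow, eventually_ge_atTop n, eventually_ge_atTop 2] with N hN hnN hN2
    have hN0 : (0 : ℝ) < N := by exact_mod_cast (by lia : 0 < N)
    have hQ : 2 * N ≤ ⌊(N : ℝ) ^ (ϑ - (ϑ - 1) / 2)⌋₊ := by
      refine Nat.le_floor ?_
      have hexp : ϑ - (ϑ - 1) / 2 = (ϑ - 1) / 2 + 1 := by ring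
      rw [hexp, Real.rpow_add hN0, Real.rpow_one]
      push_cast
      gcongr
    have hmax : ∀ q ∈ Finset.Icc (N + 1) (2 * N), |f n| ≤ maxAbs f q N := by
      intro q hq
      rw [Finset.mem_Icc] at hq
      refine le_trans (le_of_eq ?_) (abs_sum_mod_eq_le_maxAbs f q N n)
      rw [Finset.sum_eq_single_of_mem n (Finset.mem_Icc.2 ⟨hn, hnN⟩), if_pos rfl]
      intro m hm hmn
      rw [Finset.mem_Icc] at hm
      rw [Nat.mod_eq_of_lt (by lia), Nat.mod_eq_of_lt (by lia), if_neg hmn]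
    have hsum : (N : ℝ) * |f n| ≤ C * N / Real.log N ^ (1 : ℝ) := by
      refine le_trans ?_ (hC N hN2)
      calc (N : ℝ) * |f n| = (Finset.Icc (N + 1) (2 * N)).card • |f n| := by
            rw [Nat.card_Icc, nsmul_eq_mul]
            congr 2
            lia
        _ ≤ ∑ q ∈ Finset.Icc (N + 1) (2 * N), maxAbs f q N :=
            Finset.card_nsmul_le_sum _ _ _ hmax
        _ ≤ _ := Finset.sum_le_sum_of_subset_of_nonneg
            (Finset.Icc_subset_Icc (by lia) hQ) fun _ _ _ => maxAbs_nonneg _ _ _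
    rw [Real.rpow_one, mul_comm C, mul_div_assoc] at hsum
    exact le_of_mul_le_mul_left hsum hN0
  exact abs_nonpos_iff.1 hle

/-- Moments of the divisor function can be inserted in the level of distribution estimate. -/
theorem HasLevel.sum_card_divisors_pow_mul_maxAbs_le {f : ℕ → ℝ} {C ϑ : ℝ} (hC : 0 < C)
    (hf : ∃ c > (0 : ℝ), ∀ n : ℕ, 2 ≤ n → |f n| ≤ c * Real.log n ^ C)
    (hlevel : HasLevel f ϑ) (hϑ : ϑ ≤ 1) (j : ℕ) {ε A : ℝ} (hε : 0 < ε) (hA : 0 < A) :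
    ∃ K > (0 : ℝ), ∀ M : ℕ, 2 ≤ M →
      ∑ q ∈ Finset.Icc 1 ⌊(M : ℝ) ^ (ϑ - ε)⌋₊, (q.divisors.card : ℝ) ^ j * maxAbs f q M
        ≤ K * M / Real.log M ^ A := by
  obtain ⟨c, hc, hf⟩ := hf
  set J : ℕ := 2 ^ (2 * j) with hJ
  obtain ⟨K₁, hK₁, hlev⟩ := hlevel ε hε (2 * A + C + J) (by positivity)
  have hlog2 : (1 / 2 : ℝ) < Real.log 2 := by linarith [Real.log_two_gt_d9]
  set F : ℝ := c + |f 1| / Real.log 2 ^ C with hF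
  have hF0 : 0 < F := by positivity
  set K₂ : ℝ := 2 * F * 3 ^ J with hK₂
  refine ⟨√(K₂ * K₁), by positivity, fun M hM => ?_⟩
  have hM2 : (2 : ℝ) ≤ M := by exact_mod_cast hM
  have hlogM : Real.log 2 ≤ Real.log M := Real.log_le_log (by norm_num) hM2
  have hlogM0 : 0 < Real.log M := by linarith
  set Q := ⌊(M : ℝ) ^ (ϑ - ε)⌋₊ with hQdef
  have hQM : Q ≤ M := by
    refine Nat.floor_le_of_le ?_
    calc (M : ℝ) ^ (ϑ - ε) ≤ (M : ℝ) ^ (1 : ℝ) :=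
          Real.rpow_le_rpow_of_exponent_le (by linarith) (by linarith)
      _ = M := Real.rpow_one _
  have hfB : ∀ n ∈ Finset.Icc 1 M, |f n| ≤ F * Real.log M ^ C := by
    intro n hn
    rw [Finset.mem_Icc] at hn
    rcases hn.1.eq_or_lt with rfl | h1
    · calc |f 1| = |f 1| / Real.log 2 ^ C * Real.log 2 ^ C := by
            rw [div_mul_cancel₀]
            positivity
        _ ≤ F * Real.log M ^ C := by
            gcongr
            rw [hF]
            linarith
    · have hn0 : (0 : ℝ) < n := by exact_mod_cast hn.1
      have hn1 : (1 : ℝ) ≤ n := by exact_mod_cast hn.1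
      have hnM : (n : ℝ) ≤ M := by exact_mod_cast hn.2
      refine (hf n h1).trans ?_
      have : c ≤ F := by
        rw [hF]
        have : 0 ≤ |f 1| / Real.log 2 ^ C := by positivity
        linarith
      have := Real.log_nonneg hn1
      gcongr
  have hmoment : ∑ q ∈ Finset.Icc 1 Q, (q.divisors.card : ℝ) ^ (2 * j) * maxAbs f q M
      ≤ K₂ * M * Real.log M ^ (C + J) := by
    calc ∑ q ∈ Finset.Icc 1 Q, (q.divisors.card : ℝ) ^ (2 * j) * maxAbs f q M
        ≤ ∑ q ∈ Finset.Icc 1 Q, 2 * F * Real.log M ^ C * M *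
            ((q.divisors.card : ℝ) ^ (2 * j) / q) := by
          refine Finset.sum_le_sum fun q hq => ?_
          rw [Finset.mem_Icc] at hq
          have hq0 : (0 : ℝ) < q := by exact_mod_cast hq.1
          have hqM : (q : ℝ) ≤ M := by exact_mod_cast hq.2.trans hQM
          have h1 : 1 ≤ (M : ℝ) / q := (one_le_div hq0).2 hqM
          calc (q.divisors.card : ℝ) ^ (2 * j) * maxAbs f q M
              ≤ (q.divisors.card : ℝ) ^ (2 * j) * (F * Real.log M ^ C * (M / q + M / q)) := by
                gcongr
                refine (maxAbs_le hq.1 (by positivity) hfB).trans ?_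
                gcongr
            _ = _ := by ring
      _ = 2 * F * Real.log M ^ C * M *
            ∑ q ∈ Finset.Icc 1 Q, (q.divisors.card : ℝ) ^ (2 * j) / q := by
          rw [Finset.mul_sum]
      _ ≤ 2 * F * Real.log M ^ C * M * (3 * Real.log M) ^ J := by
          gcongr
          refine (Finset.sum_le_sum_of_subset_of_nonneg (Finset.Icc_subset_Icc le_rfl hQM)
            fun _ _ _ => by positivity).trans ?_
          refine (sum_card_divisors_pow_div_le M (2 * j)).trans ?_
          gcongr
          exact (sum_one_div_Icc_le M).trans (by linarith)
      _ = K₂ * M * Real.log M ^ (C + J) := by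
          rw [Real.rpow_add hlogM0, Real.rpow_natCast, mul_pow, hK₂]
          ring
  refine le_of_sq_le_sq ?_ (by positivity)
  calc (∑ q ∈ Finset.Icc 1 Q, (q.divisors.card : ℝ) ^ j * maxAbs f q M) ^ 2
      ≤ (∑ q ∈ Finset.Icc 1 Q, (q.divisors.card : ℝ) ^ (2 * j) * maxAbs f q M) *
          ∑ q ∈ Finset.Icc 1 Q, maxAbs f q M := by
        refine Finset.sum_sq_le_sum_mul_sum_of_sq_le_mul _
          (fun q _ => mul_nonneg (by positivity) (maxAbs_nonneg _ _ _))
          (fun q _ => maxAbs_nonneg _ _ _) fun q _ => le_of_eq ?_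
        rw [mul_pow, ← pow_mul, mul_comm j]
        ring
    _ ≤ (K₂ * M * Real.log M ^ (C + J)) * (K₁ * M / Real.log M ^ (2 * A + C + J)) :=
        mul_le_mul hmoment (hlev M hM) (Finset.sum_nonneg fun _ _ => maxAbs_nonneg _ _ _)
          (by positivity)
    _ = (√(K₂ * K₁) * M / Real.log M ^ A) ^ 2 := by
        have hsplit : Real.log M ^ (2 * A + C + J)
            = (Real.log M ^ A) ^ 2 * Real.log M ^ (C + J) := by
          rw [← Real.rpow_natCast (Real.log M ^ A), ← Real.rpow_mul hlogM0.le,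
            ← Real.rpow_add hlogM0]
          congr 1
          push_cast
          ring
        rw [hsplit, div_pow, mul_pow, Real.sq_sqrt (by positivity)]
        field_simp

theorem eventually_rpow_le_pred_rpow {a δ : ℝ} (ha : 0 ≤ a) (ha1 : a ≤ 1) (hδ : 0 < δ) :
    ∀ᶠ N : ℕ in atTop, (N : ℝ) ^ a ≤ ((N - 1 : ℕ) : ℝ) ^ (a + δ) := by
  have hpow : ∀ᶠ N : ℕ in atTop, (2 : ℝ) ≤ ((N - 1 : ℕ) : ℝ) ^ δ :=
    ((tendsto_rpow_atTop hδ).comp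
      (tendsto_natCast_atTop_atTop.comp (tendsto_sub_atTop_nat 1))).eventually_ge_atTop 2
  filter_upwards [hpow, eventually_ge_atTop 2] with N hN hN2
  have hpos : (0 : ℝ) < ((N - 1 : ℕ) : ℝ) := by exact_mod_cast (by lia : 0 < N - 1)
  have hle : (N : ℝ) ≤ 2 * ((N - 1 : ℕ) : ℝ) := by exact_mod_cast (by lia : N ≤ 2 * (N - 1))
  calc (N : ℝ) ^ a ≤ (2 * ((N - 1 : ℕ) : ℝ)) ^ a := by gcongr
    _ = 2 ^ a * ((N - 1 : ℕ) : ℝ) ^ a := Real.mul_rpow (by norm_num) hpos.le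
    _ ≤ 2 * ((N - 1 : ℕ) : ℝ) ^ a := by
        gcongr
        calc (2 : ℝ) ^ a ≤ 2 ^ (1 : ℝ) := Real.rpow_le_rpow_of_exponent_le (by norm_num) ha1
          _ = 2 := Real.rpow_one _
    _ ≤ ((N - 1 : ℕ) : ℝ) ^ δ * ((N - 1 : ℕ) : ℝ) ^ a := by gcongr
    _ = ((N - 1 : ℕ) : ℝ) ^ (a + δ) := by rw [← Real.rpow_add hpos, add_comm]

theorem HasLevel.sum_weighted_maxAbs_isBigO {f : ℕ → ℝ} {C ϑ : ℝ} (hC : 0 < C)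
    (hf : ∃ c > (0 : ℝ), ∀ n : ℕ, 2 ≤ n → |f n| ≤ c * Real.log n ^ C)
    (hlevel : HasLevel f ϑ) (hϑ : ϑ ≤ 1) (j J : ℕ) {ε A : ℝ} (hε : 0 < ε) (hεϑ : ε ≤ ϑ)
    (hA : 0 < A) :
    (fun N : ℕ => (N : ℝ)⁻¹ * (Real.log N ^ J *
      ∑ q ∈ Finset.Icc 1 ⌊(N : ℝ) ^ (ϑ - ε)⌋₊, (q.divisors.card : ℝ) ^ j *
        (maxAbs f q (2 * N - 1) + maxAbs f q (N - 1))))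
      =O[atTop] fun N : ℕ => 1 / Real.log N ^ A := by
  obtain ⟨K, hK, hbound⟩ := hlevel.sum_card_divisors_pow_mul_maxAbs_le hC hf hϑ j
    (half_pos hε) (by positivity : 0 < A + J)
  refine Asymptotics.IsBigO.of_bound (4 * K * 2 ^ (A + J)) ?_
  filter_upwards [eventually_rpow_le_pred_rpow (sub_nonneg.2 hεϑ) (by linarith) (half_pos hε),
    eventually_ge_atTop 3] with N hN hN3
  have hN0 : (0 : ℝ) < N := by exact_mod_cast (by lia : 0 < N)
  have hlogN : 0 < Real.log N := Real.log_pos (by exact_mod_cast (by lia : 1 < N))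
  have hsum : ∀ M : ℕ, N - 1 ≤ M → M ≤ 2 * N →
      ∑ q ∈ Finset.Icc 1 ⌊(N : ℝ) ^ (ϑ - ε)⌋₊, (q.divisors.card : ℝ) ^ j * maxAbs f q M
        ≤ 2 * K * 2 ^ (A + J) * N / Real.log N ^ (A + J) := by
    intro M hM hM'
    have hMN : ((N - 1 : ℕ) : ℝ) ≤ M := by exact_mod_cast hM
    have hM2N : (M : ℝ) ≤ 2 * N := by exact_mod_cast hM'
    have hM0 : (0 : ℝ) < M := by exact_mod_cast (by lia : 0 < M)
    have hexp : (N : ℝ) ^ (ϑ - ε) ≤ (M : ℝ) ^ (ϑ - ε / 2) := by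
      refine hN.trans ?_
      have he : ϑ - ε + ε / 2 = ϑ - ε / 2 := by ring
      rw [he]
      exact Real.rpow_le_rpow (by positivity) hMN (by linarith)
    have hsq : (N : ℝ) ≤ (M : ℝ) ^ 2 := by
      have : N ≤ M ^ 2 := by nlinarith [(by lia : N ≤ M + 1), (by lia : 2 ≤ M)]
      exact_mod_cast this
    have hlog : Real.log N / 2 ≤ Real.log M := by
      have := Real.log_le_log hN0 hsq
      rw [Real.log_pow] at this
      push_cast at this
      linarith
    calc ∑ q ∈ Finset.Icc 1 ⌊(N : ℝ) ^ (ϑ - ε)⌋₊, (q.divisors.card : ℝ) ^ j * maxAbs f q M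
        ≤ ∑ q ∈ Finset.Icc 1 ⌊(M : ℝ) ^ (ϑ - ε / 2)⌋₊,
            (q.divisors.card : ℝ) ^ j * maxAbs f q M :=
          Finset.sum_le_sum_of_subset_of_nonneg
            (Finset.Icc_subset_Icc le_rfl (Nat.floor_le_floor hexp))
            fun _ _ _ => mul_nonneg (by positivity) (maxAbs_nonneg _ _ _)
      _ ≤ K * M / Real.log M ^ (A + J) := hbound M (by lia)
      _ ≤ K * (2 * N) / (Real.log N / 2) ^ (A + J) := by gcongr
      _ = 2 * K * 2 ^ (A + J) * N / Real.log N ^ (A + J) := by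
          rw [Real.div_rpow hlogN.le (by norm_num)]
          field_simp
  have hnonneg : 0 ≤ ∑ q ∈ Finset.Icc 1 ⌊(N : ℝ) ^ (ϑ - ε)⌋₊, (q.divisors.card : ℝ) ^ j *
      (maxAbs f q (2 * N - 1) + maxAbs f q (N - 1)) :=
    Finset.sum_nonneg fun _ _ => mul_nonneg (by positivity)
      (add_nonneg (maxAbs_nonneg _ _ _) (maxAbs_nonneg _ _ _))
  rw [Real.norm_of_nonneg (by positivity), Real.norm_of_nonneg (by positivity)]
  simp only [mul_add, Finset.sum_add_distrib]
  calc (N : ℝ)⁻¹ * (Real.log N ^ J *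
        ∑ q ∈ Finset.Icc 1 ⌊(N : ℝ) ^ (ϑ - ε)⌋₊,
          (q.divisors.card : ℝ) ^ j * maxAbs f q (2 * N - 1)) +
      (N : ℝ)⁻¹ * (Real.log N ^ J *
        ∑ q ∈ Finset.Icc 1 ⌊(N : ℝ) ^ (ϑ - ε)⌋₊,
          (q.divisors.card : ℝ) ^ j * maxAbs f q (N - 1))
      ≤ (N : ℝ)⁻¹ * (Real.log N ^ J * (2 * K * 2 ^ (A + J) * N / Real.log N ^ (A + J))) +
        (N : ℝ)⁻¹ * (Real.log N ^ J * (2 * K * 2 ^ (A + J) * N / Real.log N ^ (A + J))) := by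
        gcongr
        · exact hsum _ (by lia) (by lia)
        · exact hsum _ le_rfl (by lia)
    _ = 4 * K * 2 ^ (A + J) * (1 / Real.log N ^ A) := by
        rw [Real.rpow_add hlogN, Real.rpow_natCast]
        field_simp
        ring

/-- **Lemma 3.** If `|f(n)| ≪ (log n)^C` and `f` has zero-mean distribution level `ϑ`,
then for `R ≤ N^{(ϑ-ε)/2}`,
`(1/N) ∑_{n ~ N} Λ_R(n; H, l₁) Λ_R(n; H, l₂) f(n) ≪_{k,l₁,l₂,C,A,ε} (log N)^{-A}`. -/
theorem lambda_squared_f_average (f : ℕ → ℝ) (C ϑ : ℝ) (hC : 0 < C)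
    (hf : ∃ c > (0 : ℝ), ∀ n : ℕ, 2 ≤ n → |f n| ≤ c * Real.log n ^ C)
    (hlevel : HasLevel f ϑ)
    (k l₁ l₂ : ℕ) (H : Finset ℕ) (hH : H.card = k) (ε : ℝ) (hε : 0 < ε)
    (A : ℝ) (hA : 0 < A) :
    ∃ K > (0 : ℝ), ∀ N : ℕ, 2 ≤ N → ∀ R : ℝ, 1 < R → R ≤ (N : ℝ) ^ ((ϑ - ε) / 2) →
      |(N : ℝ)⁻¹ * ∑ n ∈ Finset.Ico N (2 * N), LambdaR R n H l₁ * LambdaR R n H l₂ * f n|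
        ≤ K / Real.log N ^ A := by
  subst hH
  rcases lt_or_ge 1 ϑ with hϑ | hϑ
  · refine ⟨1, one_pos, fun N hN R _ _ => ?_⟩
    have hzero : ∑ n ∈ Finset.Ico N (2 * N), LambdaR R n H l₁ * LambdaR R n H l₂ * f n = 0 := by
      refine Finset.sum_eq_zero fun n hn => ?_
      have hn1 : 1 ≤ n := by
        rw [Finset.mem_Ico] at hn
        lia
      rw [hlevel.eq_zero hϑ hn1, mul_zero]
    have hlog : 0 ≤ Real.log N := Real.log_natCast_nonneg N
    rw [hzero, mul_zero, abs_zero]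
    positivity
  rcases le_or_gt ϑ ε with hεϑ | hεϑ
  · refine ⟨1, one_pos, fun N hN R hR1 hR => absurd hR1 (not_lt.2 (hR.trans ?_))⟩
    exact Real.rpow_le_one_of_one_le_of_nonpos (by exact_mod_cast (by lia : 1 ≤ N))
      (by linarith)
  obtain ⟨K, hK, hbound⟩ := Asymptotics.bound_of_isBigO_nat_atTop
    (hlevel.sum_weighted_maxAbs_isBigO hC hf hϑ (H.card + 2)
      ((H.card + l₁) + (H.card + l₂)) hε hεϑ.le hA)
  refine ⟨K, hK, fun N hN R hR1 hR => ?_⟩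
  have hN1 : (1 : ℝ) < N := by exact_mod_cast hN
  have hlogN : 0 < Real.log N := Real.log_pos hN1
  have hB := hbound (x := N) (by positivity)
  rw [Real.norm_of_nonneg (by positivity : (0 : ℝ) ≤ 1 / Real.log N ^ A), mul_one_div] at hB
  refine le_trans ?_ ((le_abs_self _).trans hB)
  have hRN : R ≤ N := hR.trans (by
    calc (N : ℝ) ^ ((ϑ - ε) / 2) ≤ (N : ℝ) ^ (1 : ℝ) :=
          Real.rpow_le_rpow_of_exponent_le hN1.le (by linarith)
      _ = N := Real.rpow_one _)
  have hQ : ⌊R⌋₊ * ⌊R⌋₊ ≤ ⌊(N : ℝ) ^ (ϑ - ε)⌋₊ := by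
    refine Nat.le_floor ?_
    have hfloor : (⌊R⌋₊ : ℝ) ≤ (N : ℝ) ^ ((ϑ - ε) / 2) :=
      (Nat.floor_le (by linarith)).trans hR
    push_cast
    calc (⌊R⌋₊ : ℝ) * ⌊R⌋₊ ≤ (N : ℝ) ^ ((ϑ - ε) / 2) * (N : ℝ) ^ ((ϑ - ε) / 2) := by gcongr
      _ = (N : ℝ) ^ (ϑ - ε) := by
          rw [← Real.rpow_add (by linarith), add_halves]
  have hlogR : 0 ≤ Real.log R := Real.log_nonneg hR1.le
  rw [abs_mul, abs_of_nonneg (by positivity : (0 : ℝ) ≤ (N : ℝ)⁻¹)]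
  gcongr
  refine (abs_sum_LambdaR_mul_LambdaR_le f H l₁ l₂ (by lia) hR1.le hQ).trans ?_
  gcongr
  exact Finset.sum_nonneg fun _ _ => mul_nonneg (by positivity)
    (add_nonneg (maxAbs_nonneg _ _ _) (maxAbs_nonneg _ _ _))
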